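/- Let (X, A) be a measurable space, ρ a symmetric measurable negative definite kernel on X, and w: X→[0,1] a measurable weight function. Assume that for all finite Borel measures μ ≠ ν concentrated on {w > 0} (with the integrals ∫∫|ρ|dμdμ, ∫∫|ρ|dνdν, ∫∫|ρ|dμdν finite), one has ∫∫ρ dμ dν − ½∫∫ρ dμ dμ − ½∫∫ρ dν dν > 0. Then the vertically re-scaled kernel score vrS_ρ(P,y;w) = ∫ρ(x,y)w(x)w(y)dP(x) − ½∫∫ρ(x,x')w(x)w(x')dP(x)dP(x') − ½ρ(y,y)w(y)² is strictly locally proper with respect to w and M^ρ: it is proper, localising with respect to w, and for P,Q∈M^ρ its divergence vanishes only if P(A ∩ {w>0}) = Q(A ∩ {w>0}) for all measurable A. -/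

import Mathlib

open MeasureTheory

variable {X : Type*} [MeasurableSpace X]

/-- The score divergence of the kernel score with kernel `ρ`. -/
noncomputable def scoreDiv (ρ : X → X → ℝ) (μ ν : Measure X) : ℝ :=
  (∫ x, (∫ y, ρ x y ∂ν) ∂μ) - (1/2) * (∫ x, (∫ x', ρ x x' ∂μ) ∂μ)
    - (1/2) * (∫ y, (∫ y', ρ y y' ∂ν) ∂ν)

/-- The vertically re-scaled kernel score with negative definite kernel `ρ` and
weight function `w`. -/
noncomputable def vrKS (ρ : X → X → ℝ) (w : X → ℝ) (P : Measure X) (y : X) : ℝ :=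
  (∫ x, ρ x y * w x * w y ∂P)
    - (1/2) * (∫ x, (∫ x', ρ x x' * w x * w x' ∂P) ∂P)
    - (1/2) * (ρ y y * (w y)^2)

/-- The finite measure `w · P`. -/
noncomputable def wMeas (w : X → ℝ) (P : Measure X) : Measure X :=
  P.withDensity (fun x => ENNReal.ofReal (w x))

lemma wMeas_le (w : X → ℝ) (hw : ∀ x, w x ∈ Set.Icc (0:ℝ) 1) (P : Measure X) :
    wMeas w P ≤ P := by
  calc wMeas w P ≤ P.withDensity 1 := by
        apply withDensity_mono
        filter_upwards with x
        simpa using (hw x).2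
    _ = P := withDensity_one

lemma integral_wMeas (w : X → ℝ) (hwmeas : Measurable w) (hw : ∀ x, w x ∈ Set.Icc (0:ℝ) 1)
    (P : Measure X) (f : X → ℝ) : ∫ x, f x ∂(wMeas w P) = ∫ x, w x * f x ∂P := by
  unfold wMeas
  rw [integral_withDensity_eq_integral_toReal_smul (by fun_prop) (by simp)]
  simp only [smul_eq_mul, ENNReal.toReal_ofReal (hw _).1]

lemma wMeas_compl (w : X → ℝ) (hwmeas : Measurable w) (P : Measure X) :
    wMeas w P {x | 0 < w x}ᶜ = 0 := by
  have hS : MeasurableSet {x | 0 < w x} := measurableSet_lt measurable_const hwmeas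
  unfold wMeas
  rw [withDensity_apply _ hS.compl]
  rw [setLIntegral_congr_fun (g := fun _ => 0) hS.compl]
  · simp
  · intro x hx
    simpa using hx

lemma iter_wMeas (ρ : X → X → ℝ) (w : X → ℝ) (hwmeas : Measurable w)
    (hw : ∀ x, w x ∈ Set.Icc (0:ℝ) 1) (P Q : Measure X) :
    ∫ x, (∫ y, ρ x y ∂(wMeas w Q)) ∂(wMeas w P) =
      ∫ x, (∫ y, ρ x y * w x * w y ∂Q) ∂P := by
  rw [integral_wMeas w hwmeas hw]
  congr 1
  ext x
  rw [integral_wMeas w hwmeas hw, ← integral_const_mul]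
  congr 1
  ext y
  ring

lemma scoreDiv_wMeas (ρ : X → X → ℝ) (w : X → ℝ) (hwmeas : Measurable w)
    (hw : ∀ x, w x ∈ Set.Icc (0:ℝ) 1) (P Q : Measure X) :
    scoreDiv ρ (wMeas w P) (wMeas w Q) = scoreDiv (fun x x' => ρ x x' * w x * w x') P Q := by
  simp only [scoreDiv, iter_wMeas ρ w hwmeas hw]

lemma wMeas_inj (w : X → ℝ) (hwmeas : Measurable w) (P Q : Measure X)
    (h : wMeas w P = wMeas w Q) (A : Set X) (hA : MeasurableSet A) :
    P (A ∩ {x | 0 < w x}) = Q (A ∩ {x | 0 < w x}) := by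
  have hS : MeasurableSet {x | 0 < w x} := measurableSet_lt measurable_const hwmeas
  have key : ∀ M : Measure X, M (A ∩ {x | 0 < w x}) =
      ∫⁻ x in A ∩ {x | 0 < w x}, (ENNReal.ofReal (w x))⁻¹ ∂(wMeas w M) := by
    intro M
    unfold wMeas
    rw [setLIntegral_withDensity_eq_setLIntegral_mul _ (by fun_prop) (by fun_prop) (hA.inter hS)]
    rw [setLIntegral_congr_fun (g := fun _ => 1) (hA.inter hS)]
    · simp
    · intro x hx
      exact ENNReal.mul_inv_cancel (by simpa using hx.2) (by simp)
  rw [key P, key Q, h]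

lemma kernel_cs (ρ : X → X → ℝ) (hsymm : ∀ x x', ρ x x' = ρ x' x)
    (hnd : ∀ (n : ℕ) (x : Fin n → X) (c : Fin n → ℝ),
      (∑ i, ∑ j, c i * c j * ρ (x i) (x j)) ≤ 0) (x y : X) :
    |ρ x y| ≤ Real.sqrt (-(ρ x x)) * Real.sqrt (-(ρ y y)) := by
  have h1 : ∀ z, 0 ≤ -ρ z z := by
    intro z
    have := hnd 1 (fun _ => z) (fun _ => 1)
    simp at this
    linarith
  have h2 : ∀ t : ℝ, 0 ≤ (-ρ x x) * (t * t) + (-2 * ρ x y) * t + (-ρ y y) := by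
    intro t
    have := hnd 2 ![x, y] ![t, 1]
    simp [Fin.sum_univ_two, hsymm y x] at this
    linarith
  have h3 := discrim_le_zero h2
  unfold discrim at h3
  rw [← Real.sqrt_mul (h1 x)]
  apply Real.le_sqrt_of_sq_le
  rw [sq_abs]
  linarith

lemma kernel_int (ρ : X → X → ℝ) (hsymm : ∀ x x', ρ x x' = ρ x' x)
    (hmeas : Measurable fun p : X × X => ρ p.1 p.2)
    (hnd : ∀ (n : ℕ) (x : Fin n → X) (c : Fin n → ℝ),
      (∑ i, ∑ j, c i * c j * ρ (x i) (x j)) ≤ 0) (P Q : Measure X)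
    [IsFiniteMeasure P] [IsFiniteMeasure Q]
    (hP : Integrable (fun x => Real.sqrt (-(ρ x x))) P)
    (hQ : Integrable (fun x => Real.sqrt (-(ρ x x))) Q) :
    Integrable (fun p : X × X => ρ p.1 p.2) (P.prod Q) := by
  refine (hP.mul_prod hQ).mono' hmeas.aestronglyMeasurable ?_
  filter_upwards with p
  exact kernel_cs ρ hsymm hnd p.1 p.2

/-- If `ρ` is a negative definite kernel and `−ρ` is integrally strictly positive
definite over the finite measures concentrated on `{w > 0}`, then the vertically
re-scaled kernel score is strictly locally proper with respect to `w` and `M^ρ`: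
it is proper, localising with respect to `w`, and its divergence vanishes only if
the restrictions to `{w > 0}` coincide. -/
theorem vrKernelScore_strictlyLocallyProper
    (ρ : X → X → ℝ)
    (hsymm : ∀ x x', ρ x x' = ρ x' x)
    (hmeas : Measurable fun p : X × X => ρ p.1 p.2)
    (hnd : ∀ (n : ℕ) (x : Fin n → X) (c : Fin n → ℝ),
      (∑ i, ∑ j, c i * c j * ρ (x i) (x j)) ≤ 0)
    (w : X → ℝ) (hwmeas : Measurable w) (hw : ∀ x, w x ∈ Set.Icc (0:ℝ) 1)
    (hispd : ∀ μ ν : Measure X, IsFiniteMeasure μ → IsFiniteMeasure ν → μ ≠ ν →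
      μ {x | 0 < w x}ᶜ = 0 → ν {x | 0 < w x}ᶜ = 0 →
      Integrable (fun p : X × X => |ρ p.1 p.2|) (μ.prod μ) →
      Integrable (fun p : X × X => |ρ p.1 p.2|) (ν.prod ν) →
      Integrable (fun p : X × X => |ρ p.1 p.2|) (μ.prod ν) →
      0 < scoreDiv ρ μ ν) :
    -- proper with respect to `M^ρ`
    (∀ P Q : Measure X, IsProbabilityMeasure P → IsProbabilityMeasure Q →
        Integrable (fun x => Real.sqrt (-(ρ x x))) P →
        Integrable (fun x => Real.sqrt (-(ρ x x))) Q →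
        (∫ y, vrKS ρ w Q y ∂Q) ≤ ∫ y, vrKS ρ w P y ∂Q) ∧
    -- localising with respect to `w`
    (∀ P Q : Measure X, IsProbabilityMeasure P → IsProbabilityMeasure Q →
        Integrable (fun x => Real.sqrt (-(ρ x x))) P →
        Integrable (fun x => Real.sqrt (-(ρ x x))) Q →
        (∀ A : Set X, MeasurableSet A →
          P (A ∩ {x | 0 < w x}) = Q (A ∩ {x | 0 < w x})) →
        ∀ y, vrKS ρ w P y = vrKS ρ w Q y) ∧
    -- the divergence vanishes only if the restrictions to `{w > 0}` coincide
    (∀ P Q : Measure X, IsProbabilityMeasure P → IsProbabilityMeasure Q →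
        Integrable (fun x => Real.sqrt (-(ρ x x))) P →
        Integrable (fun x => Real.sqrt (-(ρ x x))) Q →
        scoreDiv (fun x x' => ρ x x' * w x * w x') P Q = 0 →
        ∀ A : Set X, MeasurableSet A →
          P (A ∩ {x | 0 < w x}) = Q (A ∩ {x | 0 < w x})) := by
  classical
  have hdiv : ∀ P Q : Measure X, IsProbabilityMeasure P → IsProbabilityMeasure Q →
        Integrable (fun x => Real.sqrt (-(ρ x x))) P →
        Integrable (fun x => Real.sqrt (-(ρ x x))) Q →
        wMeas w P ≠ wMeas w Q →
        0 < scoreDiv (fun x x' => ρ x x' * w x * w x') P Q := by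
    intro P Q hPp hQp hP hQ hne
    have hPl := wMeas_le w hw P
    have hQl := wMeas_le w hw Q
    have : IsFiniteMeasure (wMeas w P) := isFiniteMeasure_of_le P hPl
    have : IsFiniteMeasure (wMeas w Q) := isFiniteMeasure_of_le Q hQl
    have hP' := hP.mono_measure hPl
    have hQ' := hQ.mono_measure hQl
    rw [← scoreDiv_wMeas ρ w hwmeas hw]
    exact hispd _ _ inferInstance inferInstance hne (wMeas_compl w hwmeas P)
      (wMeas_compl w hwmeas Q) (kernel_int ρ hsymm hmeas hnd _ _ hP' hP').abs
      (kernel_int ρ hsymm hmeas hnd _ _ hQ' hQ').abs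
      (kernel_int ρ hsymm hmeas hnd _ _ hP' hQ').abs
  refine ⟨?_, ?_, ?_⟩
  · intro P Q hPp hQp hP hQ
    have hnn : 0 ≤ scoreDiv (fun x x' => ρ x x' * w x * w x') Q P := by
      by_cases hne : wMeas w Q = wMeas w P
      · rw [← scoreDiv_wMeas ρ w hwmeas hw, hne]
        unfold scoreDiv
        apply le_of_eq
        ring
      · exact (hdiv Q P hQp hPp hQ hP hne).le
    have hg : ∀ M : Measure X, IsProbabilityMeasure M →
        Integrable (fun x => Real.sqrt (-(ρ x x))) M →
        Integrable (fun y => ∫ x, ρ x y * w x * w y ∂M) Q := by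
      intro M hRp hR
      have hk : Integrable (fun p : X × X => ρ p.1 p.2 * w p.1 * w p.2) (M.prod Q) := by
        refine (kernel_int ρ hsymm hmeas hnd M Q hR hQ).mono ?_ ?_
        · apply Measurable.aestronglyMeasurable
          exact (hmeas.mul (hwmeas.comp measurable_fst)).mul (hwmeas.comp measurable_snd)
        · filter_upwards with p
          rw [norm_mul, norm_mul, mul_assoc]
          apply mul_le_of_le_one_right (norm_nonneg _)
          rw [Real.norm_of_nonneg (hw _).1, Real.norm_of_nonneg (hw _).1]
          exact mul_le_one₀ (hw _).2 (hw _).1 (hw _).2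
      exact hk.integral_prod_right
    by_cases hh : Integrable (fun y => (1/2) * (ρ y y * (w y)^2)) Q
    · have hval : ∀ M : Measure X, IsProbabilityMeasure M →
          Integrable (fun x => Real.sqrt (-(ρ x x))) M →
          ∫ y, vrKS ρ w M y ∂Q = (∫ y, (∫ x, ρ y x * w y * w x ∂M) ∂Q)
            - (1/2) * (∫ x, (∫ x', ρ x x' * w x * w x' ∂M) ∂M)
            - ∫ y, (1/2) * (ρ y y * (w y)^2) ∂Q := by
        intro M hRp hR
        unfold vrKS
        have hsub : Integrable (fun y => (∫ x, ρ x y * w x * w y ∂M)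
            - (1/2) * (∫ x, (∫ x', ρ x x' * w x * w x' ∂M) ∂M)) Q :=
          (hg M hRp hR).sub (integrable_const _)
        rw [integral_sub hsub hh,
          integral_sub (hg M hRp hR) (integrable_const _)]
        have : ∀ y x, ρ x y * w x * w y = ρ y x * w y * w x := by
          intro y x
          rw [hsymm x y]
          ring
        simp only [integral_const, probReal_univ, one_smul]
        congr 3
        ext y
        congr 1
        ext x
        exact this y x
      rw [hval P hPp hP, hval Q hQp hQ]
      unfold scoreDiv at hnn
      linarith
    · have hzero : ∀ M : Measure X, IsProbabilityMeasure M →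
          Integrable (fun x => Real.sqrt (-(ρ x x))) M →
          ∫ y, vrKS ρ w M y ∂Q = 0 := by
        intro M hRp hR
        apply integral_undef
        intro hi
        apply hh
        have := ((hg M hRp hR).sub (integrable_const
          ((1/2) * (∫ x, (∫ x', ρ x x' * w x * w x' ∂M) ∂M)))).sub hi
        refine this.congr ?_
        filter_upwards with y
        simp only [vrKS, Pi.sub_apply]
        ring
      rw [hzero P hPp hP, hzero Q hQp hQ]
  · intro P Q hPp hQp hP hQ hPQ y
    have hS : MeasurableSet {x | 0 < w x} := measurableSet_lt measurable_const hwmeas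
    have hres : P.restrict {x | 0 < w x} = Q.restrict {x | 0 < w x} := by
      ext A hA
      rw [Measure.restrict_apply hA, Measure.restrict_apply hA]
      exact hPQ A hA
    have hint : ∀ f : X → ℝ, (∀ x, w x = 0 → f x = 0) → ∫ x, f x ∂P = ∫ x, f x ∂Q := by
      intro f hf
      have hf' : ∀ x, x ∉ {x | 0 < w x} → f x = 0 := by
        intro x hx
        exact hf x (le_antisymm (not_lt.mp hx) (hw x).1)
      rw [← setIntegral_eq_integral_of_forall_compl_eq_zero (μ := P) hf',
        ← setIntegral_eq_integral_of_forall_compl_eq_zero (μ := Q) hf', hres]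
    unfold vrKS
    have h1 : ∀ x, ∫ x', ρ x x' * w x * w x' ∂P = ∫ x', ρ x x' * w x * w x' ∂Q := by
      intro x
      apply hint
      intro x' hx'
      simp [hx']
    simp only [h1]
    rw [hint (fun x => ρ x y * w x * w y) (by intro x hx; simp [hx]),
      hint (fun x => ∫ x', ρ x x' * w x * w x' ∂Q) (by intro x hx; simp [hx])]
  · intro P Q hPp hQp hP hQ h0 A hA
    apply wMeas_inj w hwmeas P Q _ A hA
    by_contra hne
    exact (hdiv P Q hPp hQp hP hQ hne).ne' h0
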